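/- Let F = (f_1,…,f_n) be an S-M system on B and S the common zero set of f_1,…,f_{n-1}. Suppose S ∩ ∂B = {p₁, p₂} with p₁ ≠ p₂. Then: (1) if f_n(p₁)·f_n(p₂) ≤ 0, there is a unique point p ∈ B with f_1(p) = ⋯ = f_n(p) = 0; (2) if f_n(p₁)·f_n(p₂) > 0, there is no point p ∈ B with f_1(p) = ⋯ = f_n(p) = 0. -/

import Mathlib

/-- The partial derivative `∂f/∂x_i` at `p`. -/
noncomputable def pd {m : ℕ} (f : (Fin m → ℝ) → ℝ) (i : Fin m) (p : Fin m → ℝ) : ℝ :=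
  fderiv ℝ f p (Pi.single i 1)

/-- `f` is continuously differentiable on an open set containing `B`. -/
def C1On {m : ℕ} (f : (Fin m → ℝ) → ℝ) (B : Set (Fin m → ℝ)) : Prop :=
  ∃ U : Set (Fin m → ℝ), IsOpen U ∧ B ⊆ U ∧ ContDiffOn ℝ 1 f U

/-- `F = (f_1,…,f_m)` is an S-M system on `B ⊆ ℝ^m`: for every `k ∈ {1,…,m}`,
every strictly increasing choice of `k` column indices `c`, and all points
`q_1,…,q_k ∈ B`, the `k × k` matrix with `(j,l)`-entry `(∂f_j/∂x_{c l})(q j)`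
has nonzero determinant.  (`k` is represented as `k'+1` with `k'+1 ≤ m`.) -/
def SMSystem (m : ℕ) (f : Fin m → (Fin m → ℝ) → ℝ) (B : Set (Fin m → ℝ)) : Prop :=
  ∀ (k : ℕ) (hk : k + 1 ≤ m) (c : Fin (k+1) → Fin m), StrictMono c →
    ∀ q : Fin (k+1) → (Fin m → ℝ), (∀ j, q j ∈ B) →
      (Matrix.of fun j l : Fin (k+1) => pd (f (Fin.castLE hk j)) (c l) (q j)).det ≠ 0

open Set Filter Topology

/-- The Fréchet derivative of `g` in terms of the partial derivatives. -/
lemma fderiv_apply_eq_sum_pd {m : ℕ} (g : (Fin m → ℝ) → ℝ) (p v : Fin m → ℝ) :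
    fderiv ℝ g p v = ∑ i, pd g i p * v i := by
  conv_lhs => rw [pi_eq_sum_univ' v]
  simp only [map_sum, map_smul, smul_eq_mul, pd]
  exact Finset.sum_congr rfl fun i _ => mul_comm _ _

lemma C1On.contDiffAt {m : ℕ} {g : (Fin m → ℝ) → ℝ} {B : Set (Fin m → ℝ)} (hg : C1On g B)
    {p : Fin m → ℝ} (hp : p ∈ B) : ContDiffAt ℝ 1 g p := by
  obtain ⟨U, hU, hBU, hgU⟩ := hg
  exact hgU.contDiffAt (hU.mem_nhds (hBU hp))

lemma C1On.continuousOn {m : ℕ} {g : (Fin m → ℝ) → ℝ} {B : Set (Fin m → ℝ)} (hg : C1On g B) :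
    ContinuousOn g B :=
  fun _ hp => (hg.contDiffAt hp).continuousAt.continuousWithinAt

lemma C1On.continuousOn_pd {m : ℕ} {g : (Fin m → ℝ) → ℝ} {B : Set (Fin m → ℝ)}
    (hg : C1On g B) (i : Fin m) : ContinuousOn (pd g i) B := by
  obtain ⟨U, hU, hBU, hgU⟩ := hg
  exact ((hgU.continuousOn_fderiv_of_isOpen hU le_rfl).clm_apply continuousOn_const).mono hBU

lemma C1On.exists_sum_pd_mul_sub {m : ℕ} {g : (Fin m → ℝ) → ℝ} {B : Set (Fin m → ℝ)}
    (hg : C1On g B) (hB : Convex ℝ B) {x y : Fin m → ℝ} (hx : x ∈ B) (hy : y ∈ B) :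
    ∃ z ∈ B, ∑ i, pd g i z * (y i - x i) = g y - g x := by
  obtain ⟨z, hz, h⟩ := domain_mvt (f' := fderiv ℝ g)
    (fun p hp => ((hg.contDiffAt hp).differentiableAt one_ne_zero).hasFDerivAt.hasFDerivWithinAt)
    hB hx hy
  refine ⟨z, hB.segment_subset hx hy hz, ?_⟩
  rw [h, fderiv_apply_eq_sum_pd]
  rfl

/-- If `γ` has a positive derivative at `t₀`, it exceeds `γ t₀` immediately to the right. -/
lemma HasDerivAt.eventually_lt_right {γ : ℝ → ℝ} {γ' t₀ : ℝ} (h : HasDerivAt γ γ' t₀)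
    (hpos : 0 < γ') : ∀ᶠ t in 𝓝[>] t₀, γ t₀ < γ t := by
  have h1 : ∀ᶠ t in 𝓝[≠] t₀, 0 < slope γ t₀ t :=
    (hasDerivAt_iff_tendsto_slope.1 h).eventually (lt_mem_nhds hpos)
  filter_upwards [h1.filter_mono (nhdsWithin_mono _ fun t ht => ne_of_gt ht),
    self_mem_nhdsWithin] with t ht htt
  rw [slope_def_field, div_pos_iff_of_pos_right (sub_pos.2 htt)] at ht
  linarith

section SMSystem

variable {n : ℕ} {f : Fin (n + 2) → (Fin (n + 2) → ℝ) → ℝ} {B : Set (Fin (n + 2) → ℝ)}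

/-- A vector `v` is annihilated by the gradients of all components but the last, each taken at
its own point. -/
def InKernel (f : Fin (n + 2) → (Fin (n + 2) → ℝ) → ℝ) (q : Fin (n + 1) → Fin (n + 2) → ℝ)
    (v : Fin (n + 2) → ℝ) : Prop :=
  ∀ j : Fin (n + 1), ∑ i, pd (f j.castSucc) i (q j) * v i = 0

/-- The part of the box on which all components but the last vanish. -/
def zeroCurve (f : Fin (n + 2) → (Fin (n + 2) → ℝ) → ℝ) (B : Set (Fin (n + 2) → ℝ)) :
    Set (Fin (n + 2) → ℝ) :=
  {x | x ∈ B ∧ ∀ j : Fin (n + 1), f j.castSucc x = 0}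

/-- The gradients of all components but the last, completed to a square matrix by the first
coordinate functional. -/
noncomputable def coordGradMatrix (f : Fin (n + 2) → (Fin (n + 2) → ℝ) → ℝ)
    (q : Fin (n + 1) → Fin (n + 2) → ℝ) : Matrix (Fin (n + 2)) (Fin (n + 2)) ℝ :=
  Matrix.of (Fin.cons (Pi.single 0 1) fun j i => pd (f j.castSucc) i (q j))

lemma coordGradMatrix_mulVec_zero (q : Fin (n + 1) → Fin (n + 2) → ℝ) (v : Fin (n + 2) → ℝ) :
    (coordGradMatrix f q).mulVec v 0 = v 0 := by
  simp [coordGradMatrix, Matrix.mulVec]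

lemma coordGradMatrix_mulVec_succ (q : Fin (n + 1) → Fin (n + 2) → ℝ) (v : Fin (n + 2) → ℝ)
    (j : Fin (n + 1)) :
    (coordGradMatrix f q).mulVec v j.succ = ∑ i, pd (f j.castSucc) i (q j) * v i := by
  simp [coordGradMatrix, Matrix.mulVec, dotProduct]

namespace SMSystem

lemma eq_zero_of_inKernel (hSM : SMSystem (n + 2) f B) {q : Fin (n + 1) → Fin (n + 2) → ℝ}
    (hq : ∀ j, q j ∈ B) {v : Fin (n + 2) → ℝ} (hv : InKernel f q v) {i : Fin (n + 2)}
    (hi : v i = 0) : v = 0 := by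
  have hdet := hSM n (by omega) i.succAbove (Fin.strictMono_succAbove i) q hq
  have h0 : (fun l => v (i.succAbove l)) = 0 := by
    refine Matrix.eq_zero_of_mulVec_eq_zero hdet ?_
    ext j
    have := hv j
    rw [Fin.sum_univ_succAbove _ i, hi, mul_zero, zero_add] at this
    exact this
  ext l
  rcases Fin.eq_self_or_eq_succAbove i l with rfl | ⟨k, rfl⟩
  · exact hi
  · exact congrFun h0 k

lemma det_coordGradMatrix_ne_zero (hSM : SMSystem (n + 2) f B)
    {q : Fin (n + 1) → Fin (n + 2) → ℝ} (hq : ∀ j, q j ∈ B) : (coordGradMatrix f q).det ≠ 0 := by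
  intro h
  obtain ⟨v, hv0, hv⟩ := Matrix.exists_mulVec_eq_zero_iff.2 h
  refine hv0 (hSM.eq_zero_of_inKernel hq (i := 0) (fun j => ?_) ?_)
  · rw [← coordGradMatrix_mulVec_succ, hv]; rfl
  · rw [← coordGradMatrix_mulVec_zero (f := f) q v, hv]; rfl

/-- Kernel vectors of the gradient matrices all have the same sign pattern. -/
lemma mul_pos_of_inKernel (hSM : SMSystem (n + 2) f B) (hB : Convex ℝ B)
    (hC1 : ∀ j, C1On (f j) B)
    {q q' : Fin (n + 1) → Fin (n + 2) → ℝ} (hq : ∀ j, q j ∈ B) (hq' : ∀ j, q' j ∈ B)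
    {v v' : Fin (n + 2) → ℝ} (hv : InKernel f q v) (hv' : InKernel f q' v')
    (h0 : 0 < v 0) (h0' : 0 < v' 0) (i : Fin (n + 2)) : 0 < v i * v' i := by
  set Q : Set (Fin (n + 1) → Fin (n + 2) → ℝ) := univ.pi fun _ => B
  set w : (Fin (n + 1) → Fin (n + 2) → ℝ) → Fin (n + 2) → ℝ :=
    fun q => (coordGradMatrix f q).cramer (Pi.single 0 1)
  have hQconn : IsPreconnected Q := (convex_pi fun _ _ => hB).isPreconnected
  have hmem : ∀ {r}, (∀ j, r j ∈ B) → r ∈ Q := fun h => fun j _ => h j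
  have hwA : ∀ r, (coordGradMatrix f r).mulVec (w r) =
      (coordGradMatrix f r).det • Pi.single 0 1 := fun r => Matrix.mulVec_cramer _ _
  have hwK : ∀ r, InKernel f r (w r) := fun r j => by
    rw [← coordGradMatrix_mulVec_succ, hwA]; simp
  have hw0 : ∀ r ∈ Q, w r 0 ≠ 0 := fun r hr => by
    rw [← coordGradMatrix_mulVec_zero (f := f) r (w r), hwA]
    simpa using hSM.det_coordGradMatrix_ne_zero fun j => hr j trivial
  have hwi : ∀ r ∈ Q, w r i ≠ 0 := fun r hr h =>
    hw0 r hr (congrFun (hSM.eq_zero_of_inKernel (fun j => hr j trivial) (hwK r) h) 0)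
  have hAcont : ContinuousOn (coordGradMatrix f) Q := by
    refine continuousOn_pi.2 fun j => continuousOn_pi.2 fun l => ?_
    refine Fin.cases ?_ (fun j => ?_) j
    · exact continuousOn_const
    · exact ((hC1 j.castSucc).continuousOn_pd l).comp (continuous_apply j).continuousOn
        fun r hr => hr j trivial
  have hwcont : ContinuousOn w Q := by
    rw [continuousOn_iff_continuous_domRestrict] at hAcont ⊢
    exact hAcont.matrix_cramer continuous_const
  have hφcont : ContinuousOn (fun r => w r 0 * w r i) Q :=
    (continuousOn_pi.1 hwcont 0).mul (continuousOn_pi.1 hwcont i)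
  have hφne : ∀ r ∈ Q, w r 0 * w r i ≠ 0 := fun r hr => mul_ne_zero (hw0 r hr) (hwi r hr)
  have hord := (hQconn.image _ hφcont).ordConnected
  have hsign : 0 < (w q 0 * w q i) * (w q' 0 * w q' i) := by
    have hne := hφne q (hmem hq)
    have hne' := hφne q' (hmem hq')
    by_contra hle
    have hlt := lt_of_le_of_ne (not_lt.1 hle) (mul_ne_zero hne hne')
    have : (0 : ℝ) ∈ (fun r => w r 0 * w r i) '' Q := by
      rcases mul_neg_iff.1 hlt with ⟨h1, h2⟩ | ⟨h1, h2⟩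
      · exact hord.out (mem_image_of_mem _ (hmem hq')) (mem_image_of_mem _ (hmem hq))
          ⟨h2.le, h1.le⟩
      · exact hord.out (mem_image_of_mem _ (hmem hq)) (mem_image_of_mem _ (hmem hq'))
          ⟨h1.le, h2.le⟩
    obtain ⟨r, hr, h⟩ := this
    exact hφne r hr h
  have hprop : ∀ {r u}, (∀ j, r j ∈ B) → InKernel f r u → u i * w r 0 = u 0 * w r i := by
    intro r u hr hu
    have : (fun l => u l * w r 0 - u 0 * w r l) = 0 := by
      refine hSM.eq_zero_of_inKernel hr (i := 0) (fun j => ?_) (by ring)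
      have e : ∀ l, pd (f j.castSucc) l (r j) * (u l * w r 0 - u 0 * w r l) =
          (pd (f j.castSucc) l (r j) * u l) * w r 0 -
            u 0 * (pd (f j.castSucc) l (r j) * w r l) := fun l => by ring
      simp only [e, Finset.sum_sub_distrib, ← Finset.sum_mul, ← Finset.mul_sum, hu j, hwK r j]
      ring
    exact sub_eq_zero.1 (congrFun this i)
  have key : (v i * v' i) * (w q 0 * w q' 0) ^ 2 =
      (v 0 * v' 0) * ((w q 0 * w q i) * (w q' 0 * w q' i)) := by
    linear_combination (w q 0 * w q' 0) * ((v' i * w q' 0) * hprop hq hv +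
      (v 0 * w q i) * hprop hq' hv')
  exact pos_of_mul_pos_left (key ▸ mul_pos (mul_pos h0 h0') hsign) (sq_nonneg _)

/-- The difference of two points of the zero curve is a kernel vector. -/
lemma exists_inKernel_sub (hB : Convex ℝ B) (hC1 : ∀ j, C1On (f j) B)
    {x y : Fin (n + 2) → ℝ} (hx : x ∈ zeroCurve f B) (hy : y ∈ zeroCurve f B) :
    ∃ q : Fin (n + 1) → Fin (n + 2) → ℝ, (∀ j, q j ∈ B) ∧ InKernel f q (y - x) := by
  choose q hq h using fun j : Fin (n + 1) =>
    (hC1 j.castSucc).exists_sum_pd_mul_sub hB hx.1 hy.1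
  refine ⟨q, hq, fun j => ?_⟩
  simpa [hx.2 j, hy.2 j] using h j

/-- An S-M system is injective on a convex set. -/
lemma injOn (hSM : SMSystem (n + 2) f B) (hB : Convex ℝ B) (hC1 : ∀ j, C1On (f j) B) :
    InjOn (fun x j => f j x) B := by
  intro x hx y hy hxy
  choose q hq h using fun j => (hC1 j).exists_sum_pd_mul_sub hB hx hy
  have hdet := hSM (n + 1) le_rfl id strictMono_id q hq
  have h0 : y - x = 0 := by
    refine Matrix.eq_zero_of_mulVec_eq_zero hdet ?_
    ext j
    have := h j
    rw [show f j y = f j x from (congrFun hxy j).symm, sub_self] at this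
    exact this
  exact (sub_eq_zero.1 h0).symm

lemma injOn_eval_zero (hSM : SMSystem (n + 2) f B) (hB : Convex ℝ B) (hC1 : ∀ j, C1On (f j) B) :
    InjOn (fun x => x 0) (zeroCurve f B) := by
  intro x hx y hy hxy
  obtain ⟨q, hq, h⟩ := exists_inKernel_sub hB hC1 hx hy
  have := hSM.eq_zero_of_inKernel hq h (i := 0) (by simpa [sub_eq_zero] using hxy.symm)
  exact (sub_eq_zero.1 this).symm

/-- Near each of its points, the common zero set of all components but the last contains a curve
parametrized by the first coordinate. -/
lemma exists_local_curve (hSM : SMSystem (n + 2) f B) (hC1 : ∀ j, C1On (f j) B)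
    {p : Fin (n + 2) → ℝ} (hp : p ∈ zeroCurve f B) :
    ∃ (γ : ℝ → Fin (n + 2) → ℝ) (v : Fin (n + 2) → ℝ), γ (p 0) = p ∧ HasDerivAt γ v (p 0) ∧
      v 0 = 1 ∧ InKernel f (fun _ => p) v ∧
      ∀ᶠ t in 𝓝 (p 0), γ t 0 = t ∧ ∀ j : Fin (n + 1), f j.castSucc (γ t) = 0 := by
  set G : (Fin (n + 2) → ℝ) → Fin (n + 2) → ℝ :=
    fun x => Fin.cons (x 0) fun j => f j.castSucc x with hG
  set A := coordGradMatrix f fun _ => p with hA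
  have hdet : A.det ≠ 0 := hSM.det_coordGradMatrix_ne_zero fun _ => hp.1
  have hinj : Function.Injective A.mulVecLin := by
    rw [← LinearMap.ker_eq_bot, LinearMap.ker_eq_bot']
    intro v hv
    exact Matrix.eq_zero_of_mulVec_eq_zero hdet hv
  set L := (LinearEquiv.ofInjectiveEndo A.mulVecLin hinj).toContinuousLinearEquiv
  have hLA : ∀ v, L v = A.mulVec v := fun v => rfl
  have hderiv : HasStrictFDerivAt G (L : (Fin (n + 2) → ℝ) →L[ℝ] Fin (n + 2) → ℝ) p := by
    refine hasStrictFDerivAt_pi'.2 fun j => ?_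
    refine Fin.cases ?_ (fun j => ?_) j
    · have e : (ContinuousLinearMap.proj 0).comp
          (L : (Fin (n + 2) → ℝ) →L[ℝ] Fin (n + 2) → ℝ) = ContinuousLinearMap.proj 0 :=
        ContinuousLinearMap.ext fun v => coordGradMatrix_mulVec_zero _ v
      rw [e]
      exact hasStrictFDerivAt_apply (𝕜 := ℝ) (0 : Fin (n + 2)) p
    · have e : (ContinuousLinearMap.proj j.succ).comp
          (L : (Fin (n + 2) → ℝ) →L[ℝ] Fin (n + 2) → ℝ) = fderiv ℝ (f j.castSucc) p :=
        ContinuousLinearMap.ext fun v =>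
          (coordGradMatrix_mulVec_succ _ v j).trans (fderiv_apply_eq_sum_pd _ p v).symm
      rw [e]
      exact ((hC1 j.castSucc).contDiffAt hp.1).hasStrictFDerivAt one_ne_zero
  have hGp : G p = Pi.single 0 (p 0) := by
    ext j
    refine Fin.cases ?_ (fun j => ?_) j
    · simp [hG]
    · simp [hG, hp.2 j]
  have hline : HasDerivAt (fun t : ℝ => (Pi.single 0 t : Fin (n + 2) → ℝ)) (Pi.single 0 1)
      (p 0) := by
    refine hasDerivAt_pi.2 fun j => ?_
    refine Fin.cases ?_ (fun j => ?_) j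
    · simpa using hasDerivAt_id' (p 0)
    · simpa using hasDerivAt_const (p 0) (0 : ℝ)
  have hLv : A.mulVec (L.symm (Pi.single 0 1)) = Pi.single 0 1 := by
    rw [← hLA, ContinuousLinearEquiv.apply_symm_apply]
  refine ⟨fun t => hderiv.localInverse G L p (Pi.single 0 t), L.symm (Pi.single 0 1),
    ?_, ?_, ?_, fun j => ?_, ?_⟩
  · simp only [← hGp, hderiv.localInverse_apply_image]
  · have := hderiv.to_localInverse.hasFDerivAt
    rw [hGp] at this
    exact this.comp_hasDerivAt (p 0) hline
  · rw [← coordGradMatrix_mulVec_zero (f := f) (fun _ => p) (L.symm _), ← hA, hLv, Pi.single_eq_same]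
  · rw [← coordGradMatrix_mulVec_succ (fun _ => p), ← hA, hLv]; simp
  · have h := hderiv.eventually_right_inverse
    rw [hGp] at h
    filter_upwards [hline.continuousAt.eventually h] with t ht
    refine ⟨?_, fun j => ?_⟩
    · simpa [hG] using congrFun ht 0
    · simpa [hG] using congrFun ht j.succ

lemma image_zeroCurve_mem_nhds (hSM : SMSystem (n + 2) f B) (hC1 : ∀ j, C1On (f j) B)
    {p : Fin (n + 2) → ℝ} (hp : p ∈ zeroCurve f B) (hpB : p ∈ interior B) :
    (fun x => x 0) '' zeroCurve f B ∈ 𝓝 (p 0) := by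
  obtain ⟨γ, v, hγp, hγ, -, -, hev⟩ := hSM.exists_local_curve hC1 hp
  have : ∀ᶠ t in 𝓝 (p 0), γ t ∈ B :=
    hγ.continuousAt.eventually (by rw [hγp]; exact mem_interior_iff_mem_nhds.1 hpB)
  filter_upwards [hev, this] with t ht htB
  exact ⟨γ t, ⟨htB, ht.2⟩, ht.1⟩

section Box

variable {a b : Fin (n + 2) → ℝ}

/-- From a point of the zero curve in a box, the curve continues in the direction of any other of
its points. -/
lemma image_zeroCurve_mem_nhdsGT (hSM : SMSystem (n + 2) f (Icc a b))
    (hC1 : ∀ j, C1On (f j) (Icc a b)) {p q : Fin (n + 2) → ℝ} (hp : p ∈ zeroCurve f (Icc a b))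
    (hq : q ∈ zeroCurve f (Icc a b)) (hpq : p 0 < q 0) :
    (fun x => x 0) '' zeroCurve f (Icc a b) ∈ 𝓝[>] (p 0) := by
  have hB : Convex ℝ (Icc a b) := convex_Icc a b
  obtain ⟨γ, v, hγp, hγ, hv0, hv, hev⟩ := hSM.exists_local_curve hC1 hp
  obtain ⟨r, hr, hrk⟩ := exists_inKernel_sub hB hC1 hp hq
  have hsign := hSM.mul_pos_of_inKernel hB hC1 (fun _ => hp.1) hr hv hrk
    (by rw [hv0]; exact one_pos) (sub_pos.2 hpq)
  have hbox : ∀ i, ∀ᶠ t in 𝓝[>] (p 0), a i ≤ γ t i ∧ γ t i ≤ b i := by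
    intro i
    have hγi : HasDerivAt (fun t => γ t i) (v i) (p 0) := hasDerivAt_pi.1 hγ i
    have hγpi : γ (p 0) i = p i := congrFun hγp i
    have hcont := hγi.continuousAt.mono_left (nhdsWithin_le_nhds (s := Ioi (p 0)))
    simp only [hγpi] at hcont
    rcases mul_pos_iff.1 (hsign i) with ⟨h1, h2⟩ | ⟨h1, h2⟩
    · have hlt : p i < b i := (sub_pos.1 h2).trans_le (hq.1.2 i)
      filter_upwards [hγi.eventually_lt_right h1, hcont.eventually (gt_mem_nhds hlt)]
        with t ht ht'
      exact ⟨(hp.1.1 i).trans (hγpi.ge.trans ht.le), ht'.le⟩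
    · have hlt : a i < p i := (hq.1.1 i).trans_lt (sub_neg.1 h2)
      filter_upwards [hγi.neg.eventually_lt_right (neg_pos.2 h1),
        hcont.eventually (lt_mem_nhds hlt)] with t ht ht'
      exact ⟨ht'.le, ((neg_lt_neg_iff.1 ht).le.trans hγpi.le).trans (hp.1.2 i)⟩
  filter_upwards [eventually_all.2 hbox, hev.filter_mono nhdsWithin_le_nhds] with t ht ht'
  exact ⟨γ t, ⟨⟨fun i => (ht i).1, fun i => (ht i).2⟩, ht'.2⟩, ht'.1⟩

lemma isCompact_zeroCurve (hC1 : ∀ j, C1On (f j) (Icc a b)) :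
    IsCompact (zeroCurve f (Icc a b)) := by
  have : zeroCurve f (Icc a b) =
      Icc a b ∩ (fun x (j : Fin (n + 1)) => f j.castSucc x) ⁻¹' {0} := by
    ext x
    simp [zeroCurve, funext_iff]
  rw [this]
  exact isCompact_Icc.of_isClosed_subset
    (ContinuousOn.preimage_isClosed_of_isClosed
      (continuousOn_pi.2 fun j => (hC1 j.castSucc).continuousOn) isClosed_Icc isClosed_singleton)
    inter_subset_left

lemma isCompact_image_zeroCurve (hC1 : ∀ j, C1On (f j) (Icc a b)) :
    IsCompact ((fun x => x 0) '' zeroCurve f (Icc a b)) :=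
  (isCompact_zeroCurve hC1).image (continuous_apply 0)

lemma Icc_subset_image_zeroCurve (hSM : SMSystem (n + 2) f (Icc a b))
    (hC1 : ∀ j, C1On (f j) (Icc a b)) {p q : Fin (n + 2) → ℝ} (hp : p ∈ zeroCurve f (Icc a b))
    (hq : q ∈ zeroCurve f (Icc a b)) :
    Icc (p 0) (q 0) ⊆ (fun x => x 0) '' zeroCurve f (Icc a b) := by
  refine IsClosed.Icc_subset_of_forall_mem_nhdsWithin
    ((isCompact_image_zeroCurve hC1).isClosed.inter isClosed_Icc) ⟨p, hp, rfl⟩ ?_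
  rintro _ ⟨⟨x, hx, rfl⟩, -, hxq⟩
  exact hSM.image_zeroCurve_mem_nhdsGT hC1 hx hq hxq

/-- The inverse of the first coordinate function on the zero curve is continuous. -/
lemma exists_continuousOn_section (hSM : SMSystem (n + 2) f (Icc a b))
    (hC1 : ∀ j, C1On (f j) (Icc a b)) :
    ∃ g : ℝ → Fin (n + 2) → ℝ, (∀ x ∈ zeroCurve f (Icc a b), g (x 0) = x) ∧
      ContinuousOn g ((fun x => x 0) '' zeroCurve f (Icc a b)) := by
  set K := zeroCurve f (Icc a b)
  have hinj : InjOn (fun x : Fin (n + 2) → ℝ => x 0) K := hSM.injOn_eval_zero (convex_Icc a b) hC1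
  have hleft : ∀ x ∈ K, Function.invFunOn (fun x => x 0) K (x 0) = x :=
    fun x hx => hinj.leftInvOn_invFunOn hx
  refine ⟨Function.invFunOn (fun x => x 0) K, hleft, ?_⟩
  refine continuousOn_iff_isClosed.2 fun t ht => ⟨(fun x => x 0) '' (K ∩ t), ?_, ?_⟩
  · exact (((isCompact_zeroCurve hC1).inter_right ht).image (continuous_apply 0)).isClosed
  · ext s
    constructor
    · rintro ⟨hs, x, hx, rfl⟩
      refine ⟨⟨x, ⟨hx, ?_⟩, rfl⟩, x, hx, rfl⟩
      have := hleft x hx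
      simp only [mem_preimage] at hs
      rwa [this] at hs
    · rintro ⟨⟨x, ⟨hx, hxt⟩, rfl⟩, -⟩
      refine ⟨?_, x, hx, rfl⟩
      simp only [mem_preimage]
      rwa [hleft x hx]

lemma eval_zero_mem_Icc (hSM : SMSystem (n + 2) f (Icc a b))
    (hC1 : ∀ j, C1On (f j) (Icc a b)) {p₁ p₂ : Fin (n + 2) → ℝ} (hlt : p₁ 0 < p₂ 0)
    (hS : zeroCurve f (Icc a b) ∩ frontier (Icc a b) = {p₁, p₂})
    {p : Fin (n + 2) → ℝ} (hp : p ∈ zeroCurve f (Icc a b)) : p 0 ∈ Icc (p₁ 0) (p₂ 0) := by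
  have hcoord : ∀ x ∈ zeroCurve f (Icc a b), x ∉ interior (Icc a b) → x = p₁ ∨ x = p₂ := by
    intro x hx hxi
    have : x ∈ zeroCurve f (Icc a b) ∩ frontier (Icc a b) :=
      ⟨hx, by rw [isClosed_Icc.frontier_eq]; exact ⟨hx.1, hxi⟩⟩
    rwa [hS] at this
  have hcont : ContinuousOn (fun x : Fin (n + 2) → ℝ => x 0) (zeroCurve f (Icc a b)) :=
    (continuous_apply 0).continuousOn
  constructor
  · obtain ⟨x, hx, hmin⟩ := (isCompact_zeroCurve hC1).exists_isMinOn ⟨p, hp⟩ hcont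
    have hxi : x ∉ interior (Icc a b) := fun hxi => by
      obtain ⟨t, ht, y, hy, rfl⟩ :=
        ((frequently_lt_nhds (x 0)).and_eventually
          (hSM.image_zeroCurve_mem_nhds hC1 hx hxi)).exists
      exact absurd (hmin hy) (not_le.2 ht)
    rcases hcoord x hx hxi with rfl | rfl
    · exact hmin hp
    · exact hlt.le.trans (hmin hp)
  · obtain ⟨x, hx, hmax⟩ := (isCompact_zeroCurve hC1).exists_isMaxOn ⟨p, hp⟩ hcont
    have hxi : x ∉ interior (Icc a b) := fun hxi => by
      obtain ⟨t, ht, y, hy, rfl⟩ :=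
        ((frequently_gt_nhds (x 0)).and_eventually
          (hSM.image_zeroCurve_mem_nhds hC1 hx hxi)).exists
      exact absurd (hmax hy) (not_le.2 ht)
    rcases hcoord x hx hxi with rfl | rfl
    · exact le_trans (hmax hp) hlt.le
    · exact hmax hp

/-- The last component takes a value on the zero curve exactly when the value lies between those
at the two endpoints. -/
lemma image_zeroCurve_last (hSM : SMSystem (n + 2) f (Icc a b))
    (hC1 : ∀ j, C1On (f j) (Icc a b)) {p₁ p₂ : Fin (n + 2) → ℝ} (hlt : p₁ 0 < p₂ 0)
    (hS : zeroCurve f (Icc a b) ∩ frontier (Icc a b) = {p₁, p₂}) :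
    f (Fin.last (n + 1)) '' zeroCurve f (Icc a b) =
      uIcc (f (Fin.last (n + 1)) p₁) (f (Fin.last (n + 1)) p₂) := by
  have hp₁ : p₁ ∈ zeroCurve f (Icc a b) :=
    (hS.ge (mem_insert p₁ {p₂})).1
  have hp₂ : p₂ ∈ zeroCurve f (Icc a b) :=
    (hS.ge (mem_insert_of_mem p₁ rfl)).1
  obtain ⟨g, hg, hgc⟩ := hSM.exists_continuousOn_section hC1
  have hsub := hSM.Icc_subset_image_zeroCurve hC1 hp₁ hp₂
  have hgmem : ∀ t ∈ Icc (p₁ 0) (p₂ 0), g t ∈ zeroCurve f (Icc a b) ∧ g t 0 = t := by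
    intro t ht
    obtain ⟨x, hx, rfl⟩ := hsub ht
    simp only [hg x hx]
    exact ⟨hx, trivial⟩
  set h : ℝ → ℝ := fun t => f (Fin.last (n + 1)) (g t) with hh
  have hcont : ContinuousOn h (Icc (p₁ 0) (p₂ 0)) :=
    (hC1 (Fin.last (n + 1))).continuousOn.comp (hgc.mono hsub) fun t ht => (hgmem t ht).1.1
  have hinj : InjOn h (Icc (p₁ 0) (p₂ 0)) := by
    intro s hs t ht hst
    have hgs := hgmem s hs
    have hgt := hgmem t ht
    have : g s = g t := hSM.injOn (convex_Icc a b) hC1 hgs.1.1 hgt.1.1 <| by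
      ext j
      refine Fin.lastCases hst (fun j => ?_) j
      simp only [hgs.1.2 j, hgt.1.2 j]
    rw [← hgs.2, ← hgt.2, this]
  have h₁ : h (p₁ 0) = f (Fin.last (n + 1)) p₁ := by simp only [hh, hg p₁ hp₁]
  have h₂ : h (p₂ 0) = f (Fin.last (n + 1)) p₂ := by simp only [hh, hg p₂ hp₂]
  have himage : f (Fin.last (n + 1)) '' zeroCurve f (Icc a b) = h '' Icc (p₁ 0) (p₂ 0) := by
    ext y
    constructor
    · rintro ⟨x, hx, rfl⟩
      exact ⟨x 0, hSM.eval_zero_mem_Icc hC1 hlt hS hx, by simp only [hh, hg x hx]⟩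
    · rintro ⟨t, ht, rfl⟩
      exact ⟨g t, (hgmem t ht).1, rfl⟩
  rw [himage, ← h₁, ← h₂]
  refine Subset.antisymm ?_ ?_
  · rintro _ ⟨t, ht, rfl⟩
    rcases hcont.strictMonoOn_of_injOn_Icc' hlt.le hinj with hm | hm
    · exact Icc_subset_uIcc (hm.monotoneOn.mapsTo_Icc ht)
    · exact Icc_subset_uIcc' (hm.antitoneOn.mapsTo_Icc ht)
  · rw [← uIcc_of_le hlt.le] at hcont ⊢
    exact intermediate_value_uIcc hcont

end Box

end SMSystem

end SMSystem

/-- Existence test for an S-M system: if the curve `S = V(f_1,…,f_{n-1})` meets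
`∂B` in exactly two distinct points `p₁ ≠ p₂`, then (1) `f_n(p₁)·f_n(p₂) ≤ 0`
implies a unique zero of `F` in `B`, and (2) `f_n(p₁)·f_n(p₂) > 0` implies no
zero of `F` in `B`. -/
theorem SMSystem.existence_test (n : ℕ) (a b : Fin (n+2) → ℝ)
    (hab : ∀ i, a i < b i) (f : Fin (n+2) → (Fin (n+2) → ℝ) → ℝ)
    (hC1 : ∀ j, C1On (f j) (Set.Icc a b))
    (hSM : SMSystem (n+2) f (Set.Icc a b))
    (p₁ p₂ : Fin (n+2) → ℝ) (hne : p₁ ≠ p₂)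
    (hS : {x | ∀ j : Fin (n+1), f j.castSucc x = 0} ∩ frontier (Set.Icc a b) = {p₁, p₂}) :
    (f (Fin.last (n+1)) p₁ * f (Fin.last (n+1)) p₂ ≤ 0 →
      ∃! p : Fin (n+2) → ℝ, p ∈ Set.Icc a b ∧ ∀ j, f j p = 0) ∧
    (f (Fin.last (n+1)) p₁ * f (Fin.last (n+1)) p₂ > 0 →
      ¬ ∃ p : Fin (n+2) → ℝ, p ∈ Set.Icc a b ∧ ∀ j, f j p = 0) := by
  have hcurve : zeroCurve f (Set.Icc a b) ∩ frontier (Set.Icc a b) = {p₁, p₂} := by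
    rw [← hS]
    ext x
    exact ⟨fun h => ⟨h.1.2, h.2⟩, fun h => ⟨⟨isClosed_Icc.frontier_subset h.2, h.1⟩, h.2⟩⟩
  have hp₁ : p₁ ∈ zeroCurve f (Set.Icc a b) := (hcurve.ge (mem_insert p₁ {p₂})).1
  have hp₂ : p₂ ∈ zeroCurve f (Set.Icc a b) := (hcurve.ge (mem_insert_of_mem p₁ rfl)).1
  have himage : f (Fin.last (n+1)) '' zeroCurve f (Set.Icc a b) =
      uIcc (f (Fin.last (n+1)) p₁) (f (Fin.last (n+1)) p₂) := by
    rcases lt_trichotomy (p₁ 0) (p₂ 0) with hlt | heq | hlt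
    · exact hSM.image_zeroCurve_last hC1 hlt hcurve
    · exact absurd (hSM.injOn_eval_zero (convex_Icc a b) hC1 hp₁ hp₂ heq) hne
    · rw [uIcc_comm]
      exact hSM.image_zeroCurve_last hC1 hlt (by rw [hcurve, pair_comm])
  have hzero : (∃ p : Fin (n+2) → ℝ, p ∈ Set.Icc a b ∧ ∀ j, f j p = 0) ↔
      f (Fin.last (n+1)) p₁ * f (Fin.last (n+1)) p₂ ≤ 0 := by
    have hmem : (0 : ℝ) ∈ uIcc (f (Fin.last (n+1)) p₁) (f (Fin.last (n+1)) p₂) ↔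
        f (Fin.last (n+1)) p₁ * f (Fin.last (n+1)) p₂ ≤ 0 := by
      rw [mem_uIcc, mul_nonpos_iff]
      tauto
    rw [← hmem, ← himage]
    constructor
    · rintro ⟨p, hp, hfp⟩
      exact ⟨p, ⟨hp, fun j => hfp _⟩, hfp _⟩
    · rintro ⟨p, ⟨hp, hfp⟩, hlast⟩
      exact ⟨p, hp, fun j => Fin.lastCases hlast hfp j⟩
  refine ⟨fun h => ?_, fun h hex => absurd (hzero.1 hex) (not_le.2 h)⟩
  obtain ⟨p, hp, hfp⟩ := hzero.2 h
  refine ⟨p, ⟨hp, hfp⟩, ?_⟩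
  rintro q ⟨hq, hfq⟩
  refine hSM.injOn (convex_Icc a b) hC1 hq hp ?_
  ext j
  simp only [hfp j, hfq j]
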